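/- Let s be a string and let 1 ≤ i ≤ |s| be such that s[i..|s|] is a palindrome; let v = s[i..|s|]. Then v occurs exactly once in s (i.e., |occ(s,v)| = 1) if and only if linkcnt(s,v) = 0 and cnt(s,v) = 1. -/

import Mathlib

noncomputable section
open scoped Classical

namespace DEE

variable {α : Type*}

/-- 1-indexed substring `s[i..j]` (empty if `i > j`). -/
def substr (s : List α) (i j : ℕ) : List α := (s.drop (i - 1)).take (j + 1 - i)

/-- Set of start positions (1-indexed) of occurrences of `t` in `s`. -/
def occ (s t : List α) : Set ℕ :=
  {i | 1 ≤ i ∧ i + t.length - 1 ≤ s.length ∧ (s.drop (i - 1)).take t.length = t}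

/-- `v` is a non-empty palindromic substring of `s`. -/
def IsPalSub (s v : List α) : Prop := v ≠ [] ∧ v.Palindrome ∧ v <:+: s

/-- `prelen s i`: length of the longest palindromic prefix of `s[i..|s|]`. -/
def prelen (s : List α) (i : ℕ) : ℕ :=
  sSup {l | 1 ≤ l ∧ l ≤ s.length + 1 - i ∧ (substr s i (i + l - 1)).Palindrome}

/-- `suflen s i`: length of the longest palindromic suffix of `s[1..i]`. -/
def suflen (s : List α) (i : ℕ) : ℕ :=
  sSup {l | 1 ≤ l ∧ l ≤ i ∧ (substr s (i + 1 - l) i).Palindrome}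

/-- longest palindromic prefix of `s[i..|s|]`. -/
def prepal (s : List α) (i : ℕ) : List α := substr s i (i + prelen s i - 1)

/-- longest palindromic suffix of `s[1..i]`. -/
def sufpal (s : List α) (i : ℕ) : List α := substr s (i + 1 - suflen s i) i

/-- The occurrence `s[i..j]` is a surface in `s`. -/
def Surface (s : List α) (i j : ℕ) : Prop :=
  1 ≤ i ∧ i ≤ j ∧ j ≤ s.length ∧ (substr s i j).Palindrome ∧
    (∀ l, 1 ≤ l → l < i → ¬ (substr s l j).Palindrome) ∧
    (∀ r, j < r → r ≤ s.length → ¬ (substr s i r).Palindrome)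

/-- length of the longest proper palindromic suffix of `t`. -/
def linklen (t : List α) : ℕ :=
  sSup {l | l < t.length ∧ (t.drop (t.length - l)).Palindrome}

/-- the longest proper palindromic suffix of `t` (possibly `[]`). -/
def link (t : List α) : List α := t.drop (t.length - linklen t)

/-- `overline-occ`: shifted occurrences `{i + |t| - |link t| : i ∈ occ s t}`. -/
def obar (s t : List α) : Set ℕ := (fun i => i + t.length - (link t).length) '' occ s t

/-- Eq.(★): the family `S` of reduced occurrence sets represents `occ` for `s`. -/
def SatStar (s : List α) (S : List α → Set ℕ) : Prop :=
  ∀ v, IsPalSub s v →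
    occ s v = S v ∪ ⋃ u ∈ {u : List α | IsPalSub s u ∧ link u = v}, (occ s u ∪ obar s u)

/-- number of non-empty palindromic substrings of `s` linking to `v`. -/
def linkcnt (s v : List α) : ℕ := {u | IsPalSub s u ∧ link u = v}.ncard

def precnt (s v : List α) : ℕ := {i | 1 ≤ i ∧ i ≤ s.length ∧ prepal s i = v}.ncard

def sufcnt (s v : List α) : ℕ := {i | 1 ≤ i ∧ i ≤ s.length ∧ sufpal s i = v}.ncard

def cnt (s v : List α) : ℕ := sufcnt s v

/-- surfaced occurrences of `v` in `s`. -/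
def surf (s v : List α) : Set ℕ := {i ∈ occ s v | Surface s i (i + v.length - 1)}

def presurf (s : List α) (i : ℕ) : List α :=
  if Surface s i (i + prelen s i - 1) then prepal s i else []

def sufsurf (s : List α) (i : ℕ) : List α :=
  if Surface s (i + 1 - suflen s i) i then sufpal s i else []

end DEE
namespace DEE

variable {α : Type*}

theorem mem_occ_iff {s v : List α} (hv : v ≠ []) {i : ℕ} :
    i ∈ occ s v ↔ ∃ a b, s = a ++ v ++ b ∧ i = a.length + 1 := by
  have hL : 0 < v.length := List.length_pos_iff.2 hv
  constructor
  · rintro ⟨hi, hle, h⟩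
    refine ⟨s.take (i - 1), (s.drop (i - 1)).drop v.length, ?_, ?_⟩
    · conv_rhs => rw [← h]
      have hlen : ((s.drop (i - 1)).take v.length).length = v.length := by rw [h]
      rw [hlen, List.append_assoc, List.take_append_drop, List.take_append_drop]
    · rw [List.length_take]
      omega
  · rintro ⟨a, b, rfl, rfl⟩
    refine ⟨by omega, ?_, by simp⟩
    simp only [List.length_append]
    omega

theorem suffix_take_iff {s v : List α} {j : ℕ} (hj : j ≤ s.length) :
    v <:+ s.take j ↔ ∃ a b, s = a ++ v ++ b ∧ j = a.length + v.length := by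
  constructor
  · rintro ⟨a, h⟩
    refine ⟨a, s.drop j, by rw [h, List.take_append_drop], ?_⟩
    have := congrArg List.length h
    rw [List.length_take, List.length_append] at this
    omega
  · rintro ⟨a, b, rfl, rfl⟩
    refine ⟨a, ?_⟩
    rw [← List.length_append, List.take_left]

theorem suffix_eq_drop {t w : List α} (h : w <:+ t) : w = t.drop (t.length - w.length) :=
  List.suffix_iff_eq_drop.1 h

theorem linklen_mem {t : List α} (ht : t ≠ []) :
    linklen t ∈ {l | l < t.length ∧ (t.drop (t.length - l)).Palindrome} := by
  apply Nat.sSup_mem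
  · exact ⟨0, List.length_pos_iff.2 ht, by simpa using List.Palindrome.nil⟩
  · exact ⟨t.length, fun l hl => hl.1.le⟩

theorem link_suffix (t : List α) : link t <:+ t := List.drop_suffix _ _

theorem link_palindrome {t : List α} (ht : t ≠ []) : (link t).Palindrome := (linklen_mem ht).2

theorem length_link {t : List α} (ht : t ≠ []) : (link t).length = linklen t := by
  have := (linklen_mem ht).1
  rw [link, List.length_drop]
  omega

theorem length_link_lt {t : List α} (ht : t ≠ []) : (link t).length < t.length := by
  rw [length_link ht]
  exact (linklen_mem ht).1

theorem length_le_length_link {t w : List α} (hw : w.Palindrome) (h : w <:+ t)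
    (hlt : w.length < t.length) : w.length ≤ (link t).length := by
  have ht : t ≠ [] := List.length_pos_iff.1 (by omega)
  rw [length_link ht]
  exact le_csSup ⟨t.length, fun l hl => hl.1.le⟩ ⟨hlt, suffix_eq_drop h ▸ hw⟩

/-- Following suffix links from a palindrome `w` reaches every proper palindromic suffix of `w`. -/
theorem exists_suffix_link_eq {v : List α} (hv : v.Palindrome) (w : List α)
    (hw : w.Palindrome) (h : v <:+ w) (hlt : v.length < w.length) :
    ∃ u, u <:+ w ∧ u ≠ [] ∧ u.Palindrome ∧ link u = v := by
  have hne : w ≠ [] := List.length_pos_iff.1 (by omega)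
  have hle := length_le_length_link hv h hlt
  have hs : v <:+ link w := List.suffix_of_suffix_length_le h (link_suffix w) hle
  rcases hle.eq_or_lt with heq | hlt'
  · exact ⟨w, List.suffix_rfl, hne, hw, (hs.eq_of_length heq).symm⟩
  · have hdec := length_link_lt hne
    obtain ⟨u, hu, hu'⟩ := exists_suffix_link_eq hv (link w) (link_palindrome hne) hs hlt'
    exact ⟨u, hu.trans (link_suffix w), hu'⟩
termination_by w.length

theorem substr_eq_drop_take {s : List α} {j l : ℕ} (hl : l ≤ j) :
    substr s (j + 1 - l) j = (s.take j).drop (j - l) := by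
  rw [substr, List.drop_take, show j + 1 - l - 1 = j - l by omega,
    show j + 1 - (j + 1 - l) = j - (j - l) by omega]

theorem suflen_mem {s : List α} {j : ℕ} (hj : 1 ≤ j) (hjs : j ≤ s.length) :
    suflen s j ∈ {l | 1 ≤ l ∧ l ≤ j ∧ (substr s (j + 1 - l) j).Palindrome} := by
  apply Nat.sSup_mem
  · refine ⟨1, le_rfl, hj, ?_⟩
    rw [substr_eq_drop_take hj]
    obtain ⟨x, hx⟩ : ∃ x, (s.take j).drop (j - 1) = [x] := by
      rw [← List.length_eq_one_iff, List.length_drop, List.length_take]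
      omega
    rw [hx]
    exact List.Palindrome.singleton x
  · exact ⟨j, fun l hl => hl.2.1⟩

theorem sufpal_eq_drop {s : List α} {j : ℕ} (hj : 1 ≤ j) (hjs : j ≤ s.length) :
    sufpal s j = (s.take j).drop (j - suflen s j) :=
  substr_eq_drop_take (suflen_mem hj hjs).2.1

theorem sufpal_suffix {s : List α} {j : ℕ} (hj : 1 ≤ j) (hjs : j ≤ s.length) :
    sufpal s j <:+ s.take j := by
  rw [sufpal_eq_drop hj hjs]
  exact List.drop_suffix _ _

theorem sufpal_palindrome {s : List α} {j : ℕ} (hj : 1 ≤ j) (hjs : j ≤ s.length) :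
    (sufpal s j).Palindrome := (suflen_mem hj hjs).2.2

theorem length_le_length_sufpal {s w : List α} {j : ℕ} (hj : 1 ≤ j) (hjs : j ≤ s.length)
    (hne : w ≠ []) (hw : w.Palindrome) (h : w <:+ s.take j) :
    w.length ≤ (sufpal s j).length := by
  have hpos : 0 < w.length := List.length_pos_iff.2 hne
  have hlen : (s.take j).length = j := by rw [List.length_take]; omega
  have hwj : w.length ≤ j := hlen ▸ h.length_le
  have hsuf := (suflen_mem hj hjs).2.1
  have hle : w.length ≤ suflen s j := by
    refine le_csSup ⟨j, fun l hl => hl.2.1⟩ ⟨hpos, hwj, ?_⟩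
    rw [substr_eq_drop_take hwj]
    have := suffix_eq_drop h
    rw [hlen] at this
    exact this ▸ hw
  rw [sufpal_eq_drop hj hjs, List.length_drop, hlen]
  omega

theorem finite_isPalSub_link (s v : List α) : {u | IsPalSub s u ∧ link u = v}.Finite :=
  s.sublists.finite_toSet.subset fun _ hu => List.mem_sublists.2 hu.1.2.2.sublist

theorem finite_occ (s v : List α) : (occ s v).Finite :=
  (Set.finite_le_nat (s.length + 1)).subset fun i hi => by
    have := hi.2.1
    have := hi.1
    change i ≤ s.length + 1
    omega

/-- If nothing links to `v`, the end positions of its occurrences are exactly the positions whose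
longest palindromic suffix is `v`. -/
theorem image_occ_eq_of_no_link {s v : List α} (hne : v ≠ []) (hv : v.Palindrome)
    (h : ∀ u, IsPalSub s u → link u ≠ v) :
    (fun i => i + v.length - 1) '' occ s v = {j | 1 ≤ j ∧ j ≤ s.length ∧ sufpal s j = v} := by
  have hpos : 0 < v.length := List.length_pos_iff.2 hne
  ext j
  constructor
  · rintro ⟨i, hi, rfl⟩
    have hjs := hi.2.1
    obtain ⟨a, b, hs, rfl⟩ := (mem_occ_iff hne).1 hi
    set j := a.length + 1 + v.length - 1 with hj
    have hj1 : 1 ≤ j := by omega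
    have hsuf : v <:+ s.take j := (suffix_take_iff hjs).2 ⟨a, b, hs, by omega⟩
    have hle := length_le_length_sufpal hj1 hjs hne hv hsuf
    have hs' := List.suffix_of_suffix_length_le hsuf (sufpal_suffix hj1 hjs) hle
    refine ⟨hj1, hjs, ?_⟩
    rcases hle.eq_or_lt with heq | hlt
    · exact (hs'.eq_of_length heq).symm
    · obtain ⟨u, hu, hune, hupal, hlink⟩ :=
        exists_suffix_link_eq hv _ (sufpal_palindrome hj1 hjs) hs' hlt
      exact absurd hlink (h u ⟨hune, hupal,
        (hu.trans (sufpal_suffix hj1 hjs)).isInfix.trans (List.take_prefix _ _).isInfix⟩)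
  · rintro ⟨hj1, hjs, heq⟩
    obtain ⟨a, b, hs, hj⟩ := (suffix_take_iff hjs).1 (heq ▸ sufpal_suffix hj1 hjs)
    refine ⟨a.length + 1, (mem_occ_iff hne).2 ⟨a, b, hs, rfl⟩, ?_⟩
    simp only
    omega

theorem ncard_occ_eq_cnt_of_no_link {s v : List α} (hne : v ≠ []) (hv : v.Palindrome)
    (h : ∀ u, IsPalSub s u → link u ≠ v) : (occ s v).ncard = cnt s v := by
  have hpos : 0 < v.length := List.length_pos_iff.2 hne
  rw [cnt, sufcnt, ← image_occ_eq_of_no_link hne hv h, Set.InjOn.ncard_image]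
  intro i hi j hj hij
  simp only at hij
  omega

theorem one_lt_ncard_occ_link {s u : List α} (hu : IsPalSub s u) (hne : link u ≠ []) :
    1 < (occ s (link u)).ncard := by
  obtain ⟨hune, hupal, a, b, rfl⟩ := hu
  have hlt := length_link_lt hune
  obtain ⟨x, hx⟩ := link_suffix u
  have hx' : link u ++ x.reverse = u := by
    have := congrArg List.reverse hx
    rwa [List.reverse_append, (link_palindrome hune).reverse_eq, hupal.reverse_eq] at this
  have hxlen := congrArg List.length hx
  rw [List.length_append] at hxlen
  rw [Set.one_lt_ncard (finite_occ _ _)]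
  refine ⟨a.length + 1, (mem_occ_iff hne).2 ⟨a, x.reverse ++ b, ?_, rfl⟩,
    (a ++ x).length + 1, (mem_occ_iff hne).2 ⟨a ++ x, b, ?_, rfl⟩, ?_⟩
  · conv_lhs => rw [← hx']
    simp only [List.append_assoc]
  · conv_lhs => rw [← hx]
    simp only [List.append_assoc]
  · rw [List.length_append]
    omega

theorem linkcnt_eq_zero_iff {s v : List α} :
    linkcnt s v = 0 ↔ ∀ u, IsPalSub s u → link u ≠ v := by
  rw [linkcnt, Set.ncard_eq_zero (finite_isPalSub_link s v), Set.eq_empty_iff_forall_notMem]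
  simp

/-- A non-empty palindrome `v` occurs exactly once in `s` iff `linkcnt s v = 0` and
`cnt s v = 1`. -/
theorem ncard_occ_eq_one_iff {s v : List α} (hne : v ≠ []) (hv : v.Palindrome) :
    (occ s v).ncard = 1 ↔ linkcnt s v = 0 ∧ cnt s v = 1 := by
  rw [linkcnt_eq_zero_iff]
  constructor
  · intro h
    have hlink : ∀ u, IsPalSub s u → link u ≠ v := by
      rintro u hu rfl
      have := one_lt_ncard_occ_link hu hne
      omega
    exact ⟨hlink, ncard_occ_eq_cnt_of_no_link hne hv hlink ▸ h⟩
  · rintro ⟨hlink, hcnt⟩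
    rw [ncard_occ_eq_cnt_of_no_link hne hv hlink, hcnt]

end DEE

/-- If `s[i..|s|]` is a palindrome `v`, then `v` occurs exactly once in
`s` iff `linkcnt(s,v) = 0` and `cnt(s,v) = 1`. -/
theorem unique_by_cnt {α : Type*} (s : List α) (i : ℕ) (h1 : 1 ≤ i) (h2 : i ≤ s.length)
    (hpal : (DEE.substr s i s.length).Palindrome) :
    (DEE.occ s (DEE.substr s i s.length)).ncard = 1 ↔
      DEE.linkcnt s (DEE.substr s i s.length) = 0 ∧
        DEE.cnt s (DEE.substr s i s.length) = 1 := by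
  refine DEE.ncard_occ_eq_one_iff (List.length_pos_iff.1 ?_) hpal
  rw [DEE.substr, List.length_take, List.length_drop]
  omega
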